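/- arXiv:2004.04767 — 2 statements merged into one kernel-verified Lean document; each statement's English description precedes it below -/
import Mathlib

section
/- Let (p_k)_{k∈ℕ} be nonnegative reals with p_0 = 0, 0 < p_1 < 1, and ∑_{k≥1} p_k = 1, and let G be the associated probability generating function. Then for all 0 < α ≤ β < 1, the path depth satisfies L_{β→α} ≥ max{ log(β/α)/log(α/G(α)) , log((1−α)/(1−β))/log((1−G(β))/(1−β)) }. -/
/-- The probability generating function of a distribution `p` on ℕ. -/
noncomputable def pgf (p : ℕ → ℝ) (s : ℝ) : ℝ := ∑' k, p k * s ^ k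

/-- The path depth `L_{β→α}`: the minimum number of iterations of the PGF needed
to bring `β` at or below `α`. -/
noncomputable def pathDepth (p : ℕ → ℝ) (β α : ℝ) : ℕ :=
  sInf {L : ℕ | (pgf p)^[L] β ≤ α}

section PgfBounds

variable {p : ℕ → ℝ}

theorem hasSum_pgf (hp : ∀ k, 0 ≤ p k) (hs : HasSum p 1) {s : ℝ} (h0 : 0 ≤ s) (h1 : s ≤ 1) :
    HasSum (fun k => p k * s ^ k) (pgf p s) :=
  (Summable.of_nonneg_of_le (fun k => mul_nonneg (hp k) (pow_nonneg h0 k))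
    (fun k => mul_le_of_le_one_right (hp k) (pow_le_one₀ h0 h1)) hs.summable).hasSum

theorem pgf_pos (hp : ∀ k, 0 ≤ p k) (hs : HasSum p 1) (hp1 : 0 < p 1) {s : ℝ} (h0 : 0 < s)
    (h1 : s ≤ 1) : 0 < pgf p s := by
  have h := le_hasSum (hasSum_pgf hp hs h0.le h1) 1
    fun k _ => mul_nonneg (hp k) (pow_nonneg h0.le k)
  have : 0 < p 1 * s ^ 1 := by positivity
  linarith

theorem pgf_lt_self (hp : ∀ k, 0 ≤ p k) (hp0 : p 0 = 0) (hs : HasSum p 1) (hp1' : p 1 < 1)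
    {s : ℝ} (h0 : 0 < s) (h1 : s < 1) : pgf p s < s := by
  have hbound := (hs.mul_right (s ^ 2)).add (hasSum_ite_eq 1 (p 1 * (s - s ^ 2)))
  have h : pgf p s ≤ 1 * s ^ 2 + p 1 * (s - s ^ 2) := by
    refine hasSum_le (fun k => ?_) (hasSum_pgf hp hs h0.le h1.le) hbound
    rcases k with _ | _ | k
    · simp [hp0]
    · simp only [zero_add, if_true]
      linarith
    · have hk : s ^ (k + 1 + 1) ≤ s ^ 2 := pow_le_pow_of_le_one h0.le h1.le (by omega)
      simpa using mul_le_mul_of_nonneg_left hk (hp (k + 1 + 1))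
  have : 0 < (1 - p 1) * (s * (1 - s)) :=
    mul_pos (by linarith) (mul_pos h0 (by linarith))
  nlinarith

/-- `s ↦ pgf p s / s` is monotone on `[0, 1]`. -/
theorem pgf_mul_le_pgf_mul (hp : ∀ k, 0 ≤ p k) (hp0 : p 0 = 0) (hs : HasSum p 1) {s t : ℝ}
    (h0 : 0 ≤ s) (hst : s ≤ t) (h1 : t ≤ 1) : pgf p s * t ≤ pgf p t * s := by
  refine hasSum_le (fun k => ?_) ((hasSum_pgf hp hs h0 (hst.trans h1)).mul_right t)
    ((hasSum_pgf hp hs (h0.trans hst) h1).mul_right s)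
  rcases k with _ | k
  · simp [hp0]
  · have hk : s ^ k ≤ t ^ k := pow_le_pow_left₀ h0 hst k
    have := mul_le_mul_of_nonneg_left hk
      (mul_nonneg (hp (k + 1)) (mul_nonneg h0 (h0.trans hst)))
    rw [pow_succ, pow_succ]
    linarith

/-- `s ↦ (1 - pgf p s) / (1 - s)` is monotone on `[0, 1)`. -/
theorem one_sub_pgf_mul_le (hp : ∀ k, 0 ≤ p k) (hs : HasSum p 1) {s t : ℝ}
    (h0 : 0 ≤ s) (hst : s ≤ t) (h1 : t ≤ 1) :
    (1 - pgf p s) * (1 - t) ≤ (1 - pgf p t) * (1 - s) := by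
  refine hasSum_le (fun k => ?_)
    ((hs.sub (hasSum_pgf hp hs h0 (hst.trans h1))).mul_right (1 - t))
    ((hs.sub (hasSum_pgf hp hs (h0.trans hst) h1)).mul_right (1 - s))
  have hk : ∑ i ∈ Finset.range k, s ^ i ≤ ∑ i ∈ Finset.range k, t ^ i :=
    Finset.sum_le_sum fun i _ => pow_le_pow_left₀ h0 hst i
  have := mul_le_mul_of_nonneg_left hk (mul_nonneg (hp k)
    (mul_nonneg (sub_nonneg.2 (hst.trans h1)) (sub_nonneg.2 h1)))
  have es : s ^ k = 1 - (∑ i ∈ Finset.range k, s ^ i) * (1 - s) := by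
    rw [geom_sum_mul_neg]; ring
  have et : t ^ k = 1 - (∑ i ∈ Finset.range k, t ^ i) * (1 - t) := by
    rw [geom_sum_mul_neg]; ring
  rw [es, et]
  linarith

theorem iterate_pgf_mem (hp : ∀ k, 0 ≤ p k) (hp0 : p 0 = 0) (hs : HasSum p 1) (hp1 : 0 < p 1)
    (hp1' : p 1 < 1) {β : ℝ} (h0 : 0 < β) (h1 : β < 1) (n : ℕ) :
    0 < (pgf p)^[n] β ∧ (pgf p)^[n] β ≤ β := by
  induction n with
  | zero => exact ⟨h0, le_rfl⟩
  | succ n ih =>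
    rw [Function.iterate_succ_apply']
    have hlt : (pgf p)^[n] β < 1 := ih.2.trans_lt h1
    exact ⟨pgf_pos hp hs hp1 ih.1 hlt.le,
      (pgf_lt_self hp hp0 hs hp1' ih.1 hlt).le.trans ih.2⟩

theorem exists_iterate_pgf_le (hp : ∀ k, 0 ≤ p k) (hp0 : p 0 = 0) (hs : HasSum p 1)
    (hp1 : 0 < p 1) (hp1' : p 1 < 1) {α β : ℝ} (hα : 0 < α) (h0 : 0 < β) (h1 : β < 1) :
    ∃ n, (pgf p)^[n] β ≤ α := by
  have hc0 : 0 < pgf p β / β := div_pos (pgf_pos hp hs hp1 h0 h1.le) h0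
  have hc1 : pgf p β / β < 1 := (div_lt_one h0).2 (pgf_lt_self hp hp0 hs hp1' h0 h1)
  have hbound : ∀ n, (pgf p)^[n] β ≤ (pgf p β / β) ^ n := by
    intro n
    induction n with
    | zero => simpa using h1.le
    | succ n ih =>
      obtain ⟨hx0, hxβ⟩ := iterate_pgf_mem hp hp0 hs hp1 hp1' h0 h1 n
      rw [Function.iterate_succ_apply', pow_succ']
      refine le_trans ?_ (mul_le_mul_of_nonneg_left ih hc0.le)
      rw [div_mul_eq_mul_div, le_div_iff₀ h0]
      exact pgf_mul_le_pgf_mul hp hp0 hs hx0.le hxβ h1.le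
  obtain ⟨n, hn⟩ := exists_pow_lt_of_lt_one hα hc1
  exact ⟨n, (hbound n).trans hn.le⟩

theorem mul_pow_le_iterate_pgf (hp : ∀ k, 0 ≤ p k) (hp0 : p 0 = 0) (hs : HasSum p 1)
    (hp1 : 0 < p 1) (hp1' : p 1 < 1) {α β : ℝ} (hα : 0 < α) (h0 : 0 < β) (h1 : β < 1) (n : ℕ)
    (hn : ∀ m < n, α ≤ (pgf p)^[m] β) : β * (pgf p α / α) ^ n ≤ (pgf p)^[n] β := by
  induction n with
  | zero => simp
  | succ n ih =>
    have hx1 := (iterate_pgf_mem hp hp0 hs hp1 hp1' h0 h1 n).2.trans h1.le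
    have hαx := hn n n.lt_succ_self
    have hc0 : 0 ≤ pgf p α / α :=
      div_nonneg (pgf_pos hp hs hp1 hα (hαx.trans hx1)).le hα.le
    rw [Function.iterate_succ_apply', pow_succ, ← mul_assoc]
    refine (mul_le_mul_of_nonneg_right (ih fun m hm => hn m (hm.trans n.lt_succ_self)) hc0).trans ?_
    rw [mul_div_assoc', div_le_iff₀ hα, mul_comm]
    exact pgf_mul_le_pgf_mul hp hp0 hs hα.le hαx hx1

theorem one_sub_iterate_pgf_le (hp : ∀ k, 0 ≤ p k) (hp0 : p 0 = 0) (hs : HasSum p 1)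
    (hp1 : 0 < p 1) (hp1' : p 1 < 1) {β : ℝ} (h0 : 0 < β) (h1 : β < 1) (n : ℕ) :
    1 - (pgf p)^[n] β ≤ (1 - β) * ((1 - pgf p β) / (1 - β)) ^ n := by
  induction n with
  | zero => simp
  | succ n ih =>
    obtain ⟨hx0, hxβ⟩ := iterate_pgf_mem hp hp0 hs hp1 hp1' h0 h1 n
    have hβ : 0 < 1 - β := sub_pos.2 h1
    have hD : 0 ≤ (1 - pgf p β) / (1 - β) :=
      div_nonneg (by linarith [pgf_lt_self hp hp0 hs hp1' h0 h1]) hβ.le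
    rw [Function.iterate_succ_apply', pow_succ, ← mul_assoc]
    refine le_trans ?_ (mul_le_mul_of_nonneg_right ih hD)
    rw [mul_div_assoc', le_div_iff₀ hβ, mul_comm (1 - (pgf p)^[n] β)]
    exact one_sub_pgf_mul_le hp hs hx0.le hxβ h1.le

end PgfBounds

/-- Lower bound on the path depth `L_{β→α}`. -/
theorem stmt7 (p : ℕ → ℝ) (hp : ∀ k, 0 ≤ p k) (hp0 : p 0 = 0)
    (hp1 : 0 < p 1) (hp1' : p 1 < 1) (hsum : ∑' k, p k = 1)
    (α β : ℝ) (hα : 0 < α) (hαβ : α ≤ β) (hβ : β < 1) :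
    max (Real.log (β / α) / Real.log (α / pgf p α))
        (Real.log ((1 - α) / (1 - β)) / Real.log ((1 - pgf p β) / (1 - β)))
      ≤ (pathDepth p β α : ℝ) := by
  have hs : HasSum p 1 := by
    have hsm : Summable p := by
      by_contra h
      rw [tsum_eq_zero_of_not_summable h] at hsum
      exact zero_ne_one hsum
    exact hsum ▸ hsm.hasSum
  have hβ0 : 0 < β := hα.trans_le hαβ
  have hα1 : α < 1 := hαβ.trans_lt hβ
  have hL : (pgf p)^[pathDepth p β α] β ≤ α :=
    Nat.sInf_mem (exists_iterate_pgf_le hp hp0 hs hp1 hp1' hα hβ0 hβ)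
  have hmin : ∀ m < pathDepth p β α, α ≤ (pgf p)^[m] β := fun m hm =>
    le_of_not_ge fun h => Nat.notMem_of_lt_sInf hm h
  have hGα := pgf_pos hp hs hp1 hα hα1.le
  refine max_le ?_ ?_
  · have hc : 1 < α / pgf p α := (one_lt_div hGα).2 (pgf_lt_self hp hp0 hs hp1' hα hα1)
    rw [div_le_iff₀ (Real.log_pos hc), ← Real.log_pow]
    refine Real.log_le_log (div_pos hβ0 hα) ?_
    have h := (mul_pow_le_iterate_pgf hp hp0 hs hp1 hp1' hα hβ0 hβ _ hmin).trans hL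
    rw [← inv_div, inv_pow, ← div_eq_mul_inv, div_le_iff₀ (by positivity)] at h
    rwa [div_le_iff₀ hα, mul_comm]
  · have hβ1 : 0 < 1 - β := sub_pos.2 hβ
    have hD : 1 < (1 - pgf p β) / (1 - β) :=
      (one_lt_div hβ1).2 (by linarith [pgf_lt_self hp hp0 hs hp1' hβ0 hβ])
    rw [div_le_iff₀ (Real.log_pos hD), ← Real.log_pow]
    refine Real.log_le_log (div_pos (sub_pos.2 hα1) hβ1) ?_
    rw [div_le_iff₀ hβ1, mul_comm]
    exact (sub_le_sub_left hL 1).trans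
      (one_sub_iterate_pgf_le hp hp0 hs hp1 hp1' hβ0 hβ _)
end

section
/- Let (p_k)_{k∈ℕ} be nonnegative reals with p_0 = 0, 0 < p_1 < 1, and ∑_{k≥1} p_k = 1, and let G be the associated probability generating function. Define H_upp(α, β) := min{ log(β/α)/log(β/G(β)) , log((1−α)/(1−β))/log((1−G(α))/(1−α)) } + 1 and H_low(α, β) := max{ log(β/α)/log(α/G(α)) , log((1−α)/(1−β))/log((1−G(β))/(1−β)) }. Then for all 0 < α ≤ β < 1 and every s ∈ [α, β], one has H_low(α, s) + H_low(s, β) − 1 ≤ L_{β→α} ≤ H_upp(α, s) + H_upp(s, β). -/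
/-- The upper-bound function `H_upp(α, β)`. -/
noncomputable def Hupp (p : ℕ → ℝ) (α β : ℝ) : ℝ :=
  min (Real.log (β / α) / Real.log (β / pgf p β))
    (Real.log ((1 - α) / (1 - β)) / Real.log ((1 - pgf p α) / (1 - α))) + 1

/-- The lower-bound function `H_low(α, β)`. -/
noncomputable def Hlow (p : ℕ → ℝ) (α β : ℝ) : ℝ :=
  max (Real.log (β / α) / Real.log (α / pgf p α))
    (Real.log ((1 - α) / (1 - β)) / Real.log ((1 - pgf p β) / (1 - β)))

section PgfBounds

variable {p : ℕ → ℝ}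

theorem summable_of_tsum_eq_one (hsum : ∑' k, p k = 1) : Summable p := by
  by_contra h
  rw [tsum_eq_zero_of_not_summable h] at hsum
  exact zero_ne_one hsum

theorem summable_mul_pow (hp : ∀ k, 0 ≤ p k) (hs : Summable p) {x : ℝ}
    (hx : x ∈ Set.Ioo (0 : ℝ) 1) : Summable fun k => p k * x ^ k :=
  Summable.of_nonneg_of_le (fun k => mul_nonneg (hp k) (pow_nonneg hx.1.le k))
    (fun k => mul_le_of_le_one_right (hp k) (pow_le_one₀ hx.1.le hx.2.le)) hs

theorem pgf_pos_s8 (hp : ∀ k, 0 ≤ p k) (hp1 : 0 < p 1) (hs : Summable p) {x : ℝ}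
    (hx : x ∈ Set.Ioo (0 : ℝ) 1) : 0 < pgf p x :=
  (summable_mul_pow hp hs hx).tsum_pos
    (fun k => mul_nonneg (hp k) (pow_nonneg hx.1.le k)) 1 (mul_pos hp1 (pow_pos hx.1 1))

theorem pgf_mono (hp : ∀ k, 0 ≤ p k) (hs : Summable p) {x y : ℝ}
    (hx : x ∈ Set.Ioo (0 : ℝ) 1) (hy : y ∈ Set.Ioo (0 : ℝ) 1) (hxy : x ≤ y) :
    pgf p x ≤ pgf p y :=
  (summable_mul_pow hp hs hx).tsum_le_tsum
    (fun k => mul_le_mul_of_nonneg_left (pow_le_pow_left₀ hx.1.le hxy k) (hp k))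
    (summable_mul_pow hp hs hy)

theorem pgf_lt_self_s8 (hp : ∀ k, 0 ≤ p k) (hp0 : p 0 = 0) (hp1' : p 1 < 1)
    (hsum : ∑' k, p k = 1) {x : ℝ} (hx : x ∈ Set.Ioo (0 : ℝ) 1) : pgf p x < x := by
  have hs := summable_of_tsum_eq_one hsum
  obtain ⟨k, hk1, hk⟩ : ∃ k, k ≠ 1 ∧ p k ≠ 0 := by
    by_contra! h
    rw [tsum_eq_single 1 h] at hsum
    exact hp1'.ne hsum
  have hk2 : 1 < k := by
    rcases k with _ | _ | k
    · exact absurd hp0 hk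
    · exact absurd rfl hk1
    · omega
  have key : pgf p x < ∑' k, p k * x := by
    refine Summable.tsum_lt_tsum (i := k) (fun j => ?_) ?_ (summable_mul_pow hp hs hx)
      (hs.mul_right x)
    · rcases j with _ | j
      · simp [hp0]
      · exact mul_le_mul_of_nonneg_left
          (pow_le_of_le_one hx.1.le hx.2.le (Nat.succ_ne_zero j)) (hp _)
    · exact mul_lt_mul_of_pos_left (pow_lt_self_of_lt_one₀ hx.1 hx.2 hk2)
        (lt_of_le_of_ne (hp k) hk.symm)
  rwa [tsum_mul_right, hsum, one_mul] at key

/-- `G(x) / x` is nondecreasing on `(0, 1)`. -/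
theorem pgf_div_self_mono (hp : ∀ k, 0 ≤ p k) (hp0 : p 0 = 0) (hs : Summable p) {x y : ℝ}
    (hx : x ∈ Set.Ioo (0 : ℝ) 1) (hy : y ∈ Set.Ioo (0 : ℝ) 1) (hxy : x ≤ y) :
    pgf p x / x ≤ pgf p y / y := by
  rw [div_le_div_iff₀ hx.1 hy.1]
  unfold pgf
  rw [← tsum_mul_right, ← tsum_mul_right]
  refine ((summable_mul_pow hp hs hx).mul_right y).tsum_le_tsum (fun k => ?_)
    ((summable_mul_pow hp hs hy).mul_right x)
  rcases k with _ | k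
  · simp [hp0]
  · have h := mul_le_mul_of_nonneg_left (pow_le_pow_left₀ hx.1.le hxy k)
      (mul_nonneg (hp (k + 1)) (mul_nonneg hx.1.le hy.1.le))
    calc p (k + 1) * x ^ (k + 1) * y = p (k + 1) * (x * y) * x ^ k := by ring
      _ ≤ p (k + 1) * (x * y) * y ^ k := h
      _ = p (k + 1) * y ^ (k + 1) * x := by ring

/-- `(1 - G(x)) / (1 - x)` is nondecreasing on `(0, 1)`. -/
theorem one_sub_pgf_div_mono (hp : ∀ k, 0 ≤ p k) (hsum : ∑' k, p k = 1) {x y : ℝ}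
    (hx : x ∈ Set.Ioo (0 : ℝ) 1) (hy : y ∈ Set.Ioo (0 : ℝ) 1) (hxy : x ≤ y) :
    (1 - pgf p x) / (1 - x) ≤ (1 - pgf p y) / (1 - y) := by
  have hs := summable_of_tsum_eq_one hsum
  have hx1 : 0 < 1 - x := sub_pos.2 hx.2
  have hy1 : 0 < 1 - y := sub_pos.2 hy.2
  rw [div_le_div_iff₀ hx1 hy1]
  unfold pgf
  have hsx := summable_mul_pow hp hs hx
  have hsy := summable_mul_pow hp hs hy
  rw [← hsum, ← hs.tsum_sub hsx, ← hs.tsum_sub hsy, hsum, ← tsum_mul_right, ← tsum_mul_right]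
  refine ((hs.sub hsx).mul_right _).tsum_le_tsum (fun k => ?_) ((hs.sub hsy).mul_right _)
  have hgx := geom_sum_mul_neg x k
  have hgy := geom_sum_mul_neg y k
  have hle : ∑ i ∈ Finset.range k, x ^ i ≤ ∑ i ∈ Finset.range k, y ^ i :=
    Finset.sum_le_sum fun i _ => pow_le_pow_left₀ hx.1.le hxy i
  have h := mul_le_mul_of_nonneg_left hle (mul_nonneg (hp k) (mul_nonneg hx1.le hy1.le))
  calc (p k - p k * x ^ k) * (1 - y) = p k * (1 - x ^ k) * (1 - y) := by ring
    _ = p k * ((1 - x) * (1 - y)) * ∑ i ∈ Finset.range k, x ^ i := by rw [← hgx]; ring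
    _ ≤ p k * ((1 - x) * (1 - y)) * ∑ i ∈ Finset.range k, y ^ i := h
    _ = p k * (1 - y ^ k) * (1 - x) := by rw [← hgy]; ring
    _ = (p k - p k * y ^ k) * (1 - x) := by ring

end PgfBounds

/-- The properties of the generating function of a nondegenerate distribution on the positive
integers with positive mass at `1` which control its iterates on `(0, 1)`. -/
structure IsContractingPgf (f : ℝ → ℝ) : Prop where
  pos : ∀ x ∈ Set.Ioo (0 : ℝ) 1, 0 < f x
  lt_self : ∀ x ∈ Set.Ioo (0 : ℝ) 1, f x < x
  mono : MonotoneOn f (Set.Ioo 0 1)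
  div_self_mono : MonotoneOn (fun x => f x / x) (Set.Ioo 0 1)
  one_sub_div_mono : MonotoneOn (fun x => (1 - f x) / (1 - x)) (Set.Ioo 0 1)

theorem isContractingPgf_pgf {p : ℕ → ℝ} (hp : ∀ k, 0 ≤ p k) (hp0 : p 0 = 0)
    (hp1 : 0 < p 1) (hp1' : p 1 < 1) (hsum : ∑' k, p k = 1) : IsContractingPgf (pgf p) where
  pos _ hx := pgf_pos_s8 hp hp1 (summable_of_tsum_eq_one hsum) hx
  lt_self _ hx := pgf_lt_self_s8 hp hp0 hp1' hsum hx
  mono _ hx _ hy hxy := pgf_mono hp (summable_of_tsum_eq_one hsum) hx hy hxy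
  div_self_mono _ hx _ hy hxy :=
    pgf_div_self_mono hp hp0 (summable_of_tsum_eq_one hsum) hx hy hxy
  one_sub_div_mono _ hx _ hy hxy := one_sub_pgf_div_mono hp hsum hx hy hxy

namespace IsContractingPgf

variable {f : ℝ → ℝ} {α β : ℝ}

theorem iterate_mem (hf : IsContractingPgf f) (hβ : β ∈ Set.Ioo (0 : ℝ) 1) (n : ℕ) :
    f^[n] β ∈ Set.Ioo (0 : ℝ) 1 := by
  induction n with
  | zero => exact hβ
  | succ n ih =>
    rw [Function.iterate_succ_apply']
    exact ⟨hf.pos _ ih, (hf.lt_self _ ih).trans ih.2⟩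

theorem iterate_antitone (hf : IsContractingPgf f) (hβ : β ∈ Set.Ioo (0 : ℝ) 1) :
    Antitone fun n => f^[n] β := by
  refine antitone_nat_of_succ_le fun n => ?_
  rw [Function.iterate_succ_apply']
  exact (hf.lt_self _ (hf.iterate_mem hβ n)).le

theorem iterate_mono (hf : IsContractingPgf f) (hα : α ∈ Set.Ioo (0 : ℝ) 1)
    (hβ : β ∈ Set.Ioo (0 : ℝ) 1) (h : α ≤ β) (n : ℕ) : f^[n] α ≤ f^[n] β := by
  induction n with
  | zero => exact h
  | succ n ih =>
    rw [Function.iterate_succ_apply', Function.iterate_succ_apply']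
    exact hf.mono (hf.iterate_mem hα n) (hf.iterate_mem hβ n) ih

theorem iterate_le (hf : IsContractingPgf f) (hβ : β ∈ Set.Ioo (0 : ℝ) 1) (n : ℕ) :
    f^[n] β ≤ β * (f β / β) ^ n := by
  induction n with
  | zero => simp
  | succ n ih =>
    have hx := hf.iterate_mem hβ n
    have h := hf.div_self_mono hx hβ (hf.iterate_antitone hβ (Nat.zero_le n))
    have h' := (div_le_iff₀ hx.1).1 h
    rw [Function.iterate_succ_apply', pow_succ]
    nlinarith [mul_le_mul_of_nonneg_left ih (div_pos (hf.pos β hβ) hβ.1).le]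

theorem le_iterate (hf : IsContractingPgf f) (hα : α ∈ Set.Ioo (0 : ℝ) 1)
    (hβ : β ∈ Set.Ioo (0 : ℝ) 1) (n : ℕ) (h : ∀ m < n, α ≤ f^[m] β) :
    β * (f α / α) ^ n ≤ f^[n] β := by
  induction n with
  | zero => simp
  | succ n ih =>
    have ih := ih fun m hm => h m (hm.trans n.lt_succ_self)
    have hx := hf.iterate_mem hβ n
    have h' := (le_div_iff₀ hx.1).1 (hf.div_self_mono hα hx (h n n.lt_succ_self))
    rw [Function.iterate_succ_apply', pow_succ]
    nlinarith [mul_le_mul_of_nonneg_left ih (div_pos (hf.pos α hα) hα.1).le]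

theorem one_lt_one_sub_div (hf : IsContractingPgf f) (hα : α ∈ Set.Ioo (0 : ℝ) 1) :
    1 < (1 - f α) / (1 - α) :=
  (one_lt_div (sub_pos.2 hα.2)).2 (sub_lt_sub_left (hf.lt_self α hα) 1)

theorem one_sub_iterate_le (hf : IsContractingPgf f) (hβ : β ∈ Set.Ioo (0 : ℝ) 1) (n : ℕ) :
    1 - f^[n] β ≤ (1 - β) * ((1 - f β) / (1 - β)) ^ n := by
  induction n with
  | zero => simp
  | succ n ih =>
    have hx := hf.iterate_mem hβ n
    have h := hf.one_sub_div_mono hx hβ (hf.iterate_antitone hβ (Nat.zero_le n))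
    have h' := (div_le_iff₀ (sub_pos.2 hx.2)).1 h
    rw [Function.iterate_succ_apply', pow_succ]
    nlinarith [mul_le_mul_of_nonneg_left ih (zero_lt_one.trans (hf.one_lt_one_sub_div hβ)).le]

theorem le_one_sub_iterate (hf : IsContractingPgf f) (hα : α ∈ Set.Ioo (0 : ℝ) 1)
    (hβ : β ∈ Set.Ioo (0 : ℝ) 1) (n : ℕ) (h : ∀ m < n, α ≤ f^[m] β) :
    (1 - β) * ((1 - f α) / (1 - α)) ^ n ≤ 1 - f^[n] β := by
  induction n with
  | zero => simp
  | succ n ih =>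
    have ih := ih fun m hm => h m (hm.trans n.lt_succ_self)
    have hx := hf.iterate_mem hβ n
    have h' := (le_div_iff₀ (sub_pos.2 hx.2)).1
      (hf.one_sub_div_mono hα hx (h n n.lt_succ_self))
    rw [Function.iterate_succ_apply', pow_succ]
    nlinarith [mul_le_mul_of_nonneg_left ih (zero_lt_one.trans (hf.one_lt_one_sub_div hα)).le]

theorem exists_iterate_le (hf : IsContractingPgf f) (hα : 0 < α)
    (hβ : β ∈ Set.Ioo (0 : ℝ) 1) : ∃ n, f^[n] β ≤ α := by
  obtain ⟨n, hn⟩ := exists_pow_lt_of_lt_one (div_pos hα hβ.1)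
    ((div_lt_one hβ.1).2 (hf.lt_self β hβ))
  refine ⟨n, (hf.iterate_le hβ n).trans ?_⟩
  rw [mul_comm]
  exact ((lt_div_iff₀ hβ.1).1 hn).le

theorem one_lt_self_div (hf : IsContractingPgf f) (hα : α ∈ Set.Ioo (0 : ℝ) 1) :
    1 < α / f α :=
  (one_lt_div (hf.pos α hα)).2 (hf.lt_self α hα)

end IsContractingPgf

/-- `log b / log a ≤ n` when `b ≤ a ^ n` and `1 < a`. -/
theorem log_div_log_le_of_le_pow {a b : ℝ} {n : ℕ} (ha : 1 < a) (hb : 0 < b)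
    (h : b ≤ a ^ n) : Real.log b / Real.log a ≤ n := by
  rw [div_le_iff₀ (Real.log_pos ha), ← Real.log_pow]
  exact Real.log_le_log hb h

/-- `n ≤ log b / log a` when `a ^ n ≤ b` and `1 < a`. -/
theorem le_log_div_log_of_pow_le {a b : ℝ} {n : ℕ} (ha : 1 < a)
    (h : a ^ n ≤ b) : n ≤ Real.log b / Real.log a := by
  rw [le_div_iff₀ (Real.log_pos ha), ← Real.log_pow]
  exact Real.log_le_log (pow_pos (zero_lt_one.trans ha) n) h

section PathDepth

variable {p : ℕ → ℝ} {α s β : ℝ}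

theorem iterate_pathDepth_le (hf : IsContractingPgf (pgf p)) (hα : 0 < α)
    (hβ : β ∈ Set.Ioo (0 : ℝ) 1) : (pgf p)^[pathDepth p β α] β ≤ α :=
  Nat.sInf_mem (s := {L : ℕ | (pgf p)^[L] β ≤ α}) (hf.exists_iterate_le hα hβ)

theorem lt_iterate_of_lt_pathDepth {n : ℕ} (hn : n < pathDepth p β α) :
    α < (pgf p)^[n] β :=
  not_le.1 (Nat.notMem_of_lt_sInf (s := {L : ℕ | (pgf p)^[L] β ≤ α}) hn)

theorem pathDepth_le {n : ℕ} (hn : (pgf p)^[n] β ≤ α) : pathDepth p β α ≤ n :=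
  Nat.sInf_le (s := {L : ℕ | (pgf p)^[L] β ≤ α}) hn

theorem Hlow_le_pathDepth (hf : IsContractingPgf (pgf p)) (hα : α ∈ Set.Ioo (0 : ℝ) 1)
    (hβ : β ∈ Set.Ioo (0 : ℝ) 1) : Hlow p α β ≤ pathDepth p β α := by
  have hL := iterate_pathDepth_le hf hα.1 hβ
  refine max_le ?_ ?_
  · refine log_div_log_le_of_le_pow (hf.one_lt_self_div hα) (div_pos hβ.1 hα.1) ?_
    have h := (hf.le_iterate hα hβ _ fun m hm => (lt_iterate_of_lt_pathDepth hm).le).trans hL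
    have hpow := pow_pos (div_pos (hf.pos α hα) hα.1) (pathDepth p β α)
    rw [← inv_div (pgf p α) α, inv_pow, div_le_iff₀ hα.1, inv_mul_eq_div, le_div_iff₀ hpow]
    exact h
  · refine log_div_log_le_of_le_pow (hf.one_lt_one_sub_div hβ)
      (div_pos (sub_pos.2 hα.2) (sub_pos.2 hβ.2)) ?_
    rw [div_le_iff₀' (sub_pos.2 hβ.2)]
    exact (sub_le_sub_left hL 1).trans (hf.one_sub_iterate_le hβ _)

theorem pathDepth_le_Hupp (hf : IsContractingPgf (pgf p)) (hα : α ∈ Set.Ioo (0 : ℝ) 1)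
    (hβ : β ∈ Set.Ioo (0 : ℝ) 1) (hαβ : α ≤ β) : pathDepth p β α ≤ Hupp p α β := by
  suffices h : ∃ n : ℕ, pathDepth p β α ≤ n + 1 ∧ α ≤ (pgf p)^[n] β ∧
      ∀ m < n, α ≤ (pgf p)^[m] β by
    obtain ⟨n, hn, hαn, hm⟩ := h
    have hn' : (pathDepth p β α : ℝ) ≤ n + 1 := by exact_mod_cast hn
    refine hn'.trans (add_le_add_left (le_min ?_ ?_) 1)
    · refine le_log_div_log_of_pow_le (hf.one_lt_self_div hβ) ?_
      have h := hαn.trans (hf.iterate_le hβ n)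
      have hpow := pow_pos (div_pos (hf.pos β hβ) hβ.1) n
      rw [← inv_div, inv_pow, le_div_iff₀ hα.1, inv_mul_eq_div, div_le_iff₀ hpow]
      exact h
    · refine le_log_div_log_of_pow_le (hf.one_lt_one_sub_div hα) ?_
      rw [le_div_iff₀' (sub_pos.2 hβ.2)]
      exact (hf.le_one_sub_iterate hα hβ n hm).trans (sub_le_sub_left hαn 1)
  rcases h : pathDepth p β α with _ | n
  · exact ⟨0, by simp, hαβ, by simp⟩
  · exact ⟨n, le_rfl, (lt_iterate_of_lt_pathDepth (by omega)).le,
      fun m hm => (lt_iterate_of_lt_pathDepth (by omega)).le⟩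

theorem pathDepth_le_add (hf : IsContractingPgf (pgf p)) (hα : 0 < α)
    (hs : s ∈ Set.Ioo (0 : ℝ) 1) (hβ : β ∈ Set.Ioo (0 : ℝ) 1) :
    pathDepth p β α ≤ pathDepth p s α + pathDepth p β s := by
  refine pathDepth_le ?_
  rw [Function.iterate_add_apply]
  exact (hf.iterate_mono (hf.iterate_mem hβ _) hs (iterate_pathDepth_le hf hs.1 hβ) _).trans
    (iterate_pathDepth_le hf hα hs)

theorem add_le_pathDepth_add_one (hf : IsContractingPgf (pgf p)) (hα : 0 < α)
    (hs : s ∈ Set.Ioo (0 : ℝ) 1) (hβ : β ∈ Set.Ioo (0 : ℝ) 1) (hαs : α ≤ s) (hsβ : s ≤ β) :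
    pathDepth p s α + pathDepth p β s ≤ pathDepth p β α + 1 := by
  have hL := iterate_pathDepth_le hf hα hβ
  rcases h₁ : pathDepth p s α with _ | m
  · have h := pathDepth_le (hL.trans hαs)
    omega
  rcases h₂ : pathDepth p β s with _ | n
  · have h := pathDepth_le ((hf.iterate_mono hs hβ hsβ _).trans hL)
    omega
  by_contra! hlt
  have hn : s < (pgf p)^[n] β := lt_iterate_of_lt_pathDepth (by omega)
  have hm : α < (pgf p)^[m] s := lt_iterate_of_lt_pathDepth (by omega)
  have hmn := hf.iterate_mono hs (hf.iterate_mem hβ n) hn.le m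
  rw [← Function.iterate_add_apply] at hmn
  have := hf.iterate_antitone hβ (show pathDepth p β α ≤ m + n by omega)
  exact absurd hL (not_le.2 (hm.trans_le (hmn.trans this)))

end PathDepth

/-- Chain bound on the path depth: for any intermediate `s ∈ [α, β]`,
`H_low(α,s) + H_low(s,β) − 1 ≤ L_{β→α} ≤ H_upp(α,s) + H_upp(s,β)`. -/
theorem stmt8 (p : ℕ → ℝ) (hp : ∀ k, 0 ≤ p k) (hp0 : p 0 = 0)
    (hp1 : 0 < p 1) (hp1' : p 1 < 1) (hsum : ∑' k, p k = 1)
    (α β : ℝ) (hα : 0 < α) (hαβ : α ≤ β) (hβ : β < 1)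
    (s : ℝ) (hs : s ∈ Set.Icc α β) :
    Hlow p α s + Hlow p s β - 1 ≤ (pathDepth p β α : ℝ) ∧
    (pathDepth p β α : ℝ) ≤ Hupp p α s + Hupp p s β := by
  have hf := isContractingPgf_pgf hp hp0 hp1 hp1' hsum
  have hs0 : 0 < s := hα.trans_le hs.1
  have hs' : s ∈ Set.Ioo (0 : ℝ) 1 := ⟨hs0, hs.2.trans_lt hβ⟩
  have hα' : α ∈ Set.Ioo (0 : ℝ) 1 := ⟨hα, hαβ.trans_lt hβ⟩
  have hβ' : β ∈ Set.Ioo (0 : ℝ) 1 := ⟨hα.trans_le hαβ, hβ⟩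
  have hlow : (pathDepth p s α + pathDepth p β s : ℝ) ≤ pathDepth p β α + 1 := by
    exact_mod_cast add_le_pathDepth_add_one hf hα hs' hβ' hs.1 hs.2
  have hupp : (pathDepth p β α : ℝ) ≤ pathDepth p s α + pathDepth p β s := by
    exact_mod_cast pathDepth_le_add hf hα hs' hβ'
  constructor
  · linarith [Hlow_le_pathDepth hf hα' hs', Hlow_le_pathDepth hf hs' hβ']
  · linarith [pathDepth_le_Hupp hf hα' hs' hs.1, pathDepth_le_Hupp hf hs' hβ' hs.2]
end
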